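/- arXiv:math/0508165 — 2 statements merged into one kernel-verified Lean document; each statement's English description precedes it below -/
import Mathlib

section
/- Let f ∈ A(𝕋ⁿ) satisfy |f(t)| ≤ C·d(t, null f)^{n/2} for all t ∈ 𝕋ⁿ and some constant C > 0, where null f = {t ∈ 𝕋ⁿ : f(t) = 0} and d is the natural metric on 𝕋ⁿ (with d(t,∅) = ∞). Then f admits spectral synthesis in A(𝕋ⁿ): for every ε > 0 there exists g ∈ A(𝕋ⁿ) vanishing on a neighborhood of null f with ‖f − g‖_{A(𝕋ⁿ)} < ε. -/
open scoped Real ENNReal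

instance : Fact (0 < 2 * π) := ⟨by positivity⟩

/-- The `n`-torus `(ℝ/2πℤ)ⁿ`. -/
abbrev Torus (n : ℕ) := Fin n → AddCircle (2 * π)

/-- The character `t ↦ e^{i k·t}` on the `n`-torus. -/
noncomputable def torusChar {n : ℕ} (k : Fin n → ℤ) (t : Torus n) : ℂ :=
  ∏ j, fourier (k j) (t j)

/-- `a` is the family of Fourier coefficients of `f : 𝕋ⁿ → ℂ`:
`f(t) = Σ_{k ∈ ℤⁿ} a_k e^{i k·t}` for every `t`. -/
def HasFourierCoeffs {n : ℕ} (f : Torus n → ℂ) (a : (Fin n → ℤ) → ℂ) : Prop :=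
  ∀ t, HasSum (fun k => a k * torusChar k t) (f t)

section BPAux

open scoped ComplexConjugate
open MeasureTheory UnitAddTorus Filter Topology

noncomputable abbrev bpMu (n : ℕ) : Measure (UnitAddTorus (Fin n)) :=
  Measure.pi fun _ => AddCircle.haarAddCircle

noncomputable def bpCoef {n : ℕ} (f : UnitAddTorus (Fin n) → ℂ) (k : Fin n → ℤ) : ℂ :=
  ∫ t, mFourier (-k) t * f t ∂(bpMu n)

lemma bp_norm_mFourier {n : ℕ} (k : Fin n → ℤ) (t : UnitAddTorus (Fin n)) :
    ‖mFourier k t‖ = 1 := by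
  simp [mFourier, fourier_apply, norm_prod, Circle.norm_coe]

lemma bp_mFourier_add {n : ℕ} (k : Fin n → ℤ) (t u : UnitAddTorus (Fin n)) :
    mFourier k (t + u) = mFourier k t * mFourier k u := by
  simp [mFourier, fourier_apply, ← Finset.prod_mul_distrib, AddCircle.toCircle_add]

lemma bp_parseval {n : ℕ} {f g : UnitAddTorus (Fin n) → ℂ} (hf : MemLp f 2 (bpMu n))
    (hg : MemLp g 2 (bpMu n)) :
    HasSum (fun k => conj (bpCoef f k) * bpCoef g k) (∫ t, conj (f t) * g t ∂(bpMu n)) := by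
  have h1 : ∀ {f : UnitAddTorus (Fin n) → ℂ} (hf : MemLp f 2 (bpMu n)) k,
      mFourierCoeff (hf.toLp f) k = bpCoef f k := by
    intro f hf k
    refine integral_congr_ae ?_
    filter_upwards [hf.coeFn_toLp] with x hx
    rw [hx, smul_eq_mul]
  have h2 : ∫ t, conj ((hf.toLp f) t) * (hg.toLp g) t ∂(bpMu n)
      = ∫ t, conj (f t) * g t ∂(bpMu n) := by
    refine integral_congr_ae ?_
    filter_upwards [hf.coeFn_toLp, hg.coeFn_toLp] with x hx hy
    rw [hx, hy]
  have := hasSum_prod_mFourierCoeff (hf.toLp f) (hg.toLp g)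
  simp only [h1] at this
  rw [← h2]
  exact this

lemma bp_parseval_norm {n : ℕ} {f : UnitAddTorus (Fin n) → ℂ} (hf : MemLp f 2 (bpMu n)) :
    HasSum (fun k => ‖bpCoef f k‖ ^ 2) (∫ t, ‖f t‖ ^ 2 ∂(bpMu n)) := by
  have h := bp_parseval hf hf
  have e : ∀ z : ℂ, conj z * z = ((‖z‖ ^ 2 : ℝ) : ℂ) := fun z => by
    rw [mul_comm, Complex.mul_conj, Complex.normSq_eq_norm_sq]
  simp only [e] at h
  rw [integral_complex_ofReal] at h
  exact_mod_cast h

lemma bp_orth {n : ℕ} (j k : Fin n → ℤ) :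
    bpCoef (fun t => mFourier j t) k = if j = k then 1 else 0 := by
  have h := (orthonormal_iff_ite.mp (orthonormal_mFourier (d := Fin n))) k j
  rw [ContinuousMap.inner_toLp] at h
  simp only [← mFourier_neg] at h
  simp only [eq_comm (a := j)]
  rw [← h]
  simp only [bpCoef, mul_comm]
  rfl

lemma bp_ball {n : ℕ} (t : UnitAddTorus (Fin n)) {δ : ℝ} (h0 : 0 ≤ δ) (h1 : 2 * δ ≤ 1) :
    (bpMu n).real (Metric.closedBall t δ) = (2 * δ) ^ n := by
  rw [measureReal_def, Measure.pi_closedBall _ _ h0]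
  have : ∀ x : UnitAddCircle, AddCircle.haarAddCircle (Metric.closedBall x δ)
      = ENNReal.ofReal (2 * δ) := by
    intro x
    have := AddCircle.volume_closedBall (T := 1) (x := x) δ
    rw [AddCircle.volume_eq_smul_haarAddCircle] at this
    simpa [h1] using this
  simp only [this, Finset.prod_const, Finset.card_univ, Fintype.card_fin, ENNReal.toReal_pow]
  rw [ENNReal.toReal_ofReal (by positivity)]

lemma bp_coef_eq {n : ℕ} {f : UnitAddTorus (Fin n) → ℂ} {a : (Fin n → ℤ) → ℂ}
    (ha : ∀ t, HasSum (fun k => a k * mFourier k t) (f t)) (hs : Summable fun k => ‖a k‖)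
    (k : Fin n → ℤ) : bpCoef f k = a k := by
  have h := hasSum_integral_of_summable_integral_norm (μ := bpMu n)
    (F := fun j t => mFourier (-k) t * (a j * mFourier j t)) (by
      intro j
      exact (Continuous.integrable_of_hasCompactSupport (by fun_prop)
        (HasCompactSupport.of_compactSpace _))) (by
      simpa [bp_norm_mFourier] using hs)
  have h2 : ∀ j, ∫ t, mFourier (-k) t * (a j * mFourier j t) ∂(bpMu n)
      = if j = k then a j else 0 := by
    intro j
    have := bp_orth j k
    rw [bpCoef] at this
    simp only [mul_left_comm _ (a j)]
    rw [integral_const_mul, this]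
    simp
  simp only [h2] at h
  have h3 : ∀ t, ∑' j, mFourier (-k) t * (a j * mFourier j t) = mFourier (-k) t * f t :=
    fun t => ((ha t).mul_left _).tsum_eq
  simp only [h3] at h
  refine h.unique ?_
  have h4 : (fun j => if j = k then a j else 0) = fun j => if j = k then a k else 0 := by
    funext j
    split_ifs with hj
    · rw [hj]
    · rfl
  rw [h4]
  exact hasSum_ite_eq k (a k)

lemma bp_cont {n : ℕ} {f : UnitAddTorus (Fin n) → ℂ} {a : (Fin n → ℤ) → ℂ}
    (ha : ∀ t, HasSum (fun k => a k * mFourier k t) (f t)) (hs : Summable fun k => ‖a k‖) :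
    Continuous f := by
  have : f = fun t => ∑' k, a k * mFourier k t := funext fun t => (ha t).tsum_eq.symm
  rw [this]
  exact continuous_tsum (fun k => by fun_prop) hs (fun k t => by simp [bp_norm_mFourier])

lemma bp_cs {ι : Type*} {u v : ι → ℝ} {A B : ℝ} (hu : ∀ i, 0 ≤ u i) (hv : ∀ i, 0 ≤ v i)
    (hA : HasSum (fun i => u i ^ 2) A) (hB : HasSum (fun i => v i ^ 2) B) :
    Summable (fun i => u i * v i) ∧ ∑' i, u i * v i ≤ √A * √B := by
  have := Real.summable_and_inner_le_Lp_mul_Lq_tsum_of_nonneg Real.HolderConjugate.two_two hu hv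
    (by simpa using hA.summable) (by simpa using hB.summable)
  refine ⟨this.1, this.2.trans_eq ?_⟩
  simp only [Real.rpow_two, hA.tsum_eq, hB.tsum_eq, Real.sqrt_eq_rpow]

/-- coefficient of the indicator of a ball -/
lemma bp_coef_ball {n : ℕ} (t : UnitAddTorus (Fin n)) (δ : ℝ) (k : Fin n → ℤ) :
    conj (bpCoef ((Metric.closedBall t δ).indicator fun _ => (1 : ℂ)) k)
      = mFourier k t * ∫ s in Metric.closedBall 0 δ, mFourier k s ∂(bpMu n) := by
  rw [bpCoef, ← integral_conj, ← integral_const_mul, ← integral_indicator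
    Metric.isClosed_closedBall.measurableSet,
    ← integral_add_left_eq_self (μ := bpMu n) _ t]
  congr 1
  ext u
  by_cases hu : u ∈ Metric.closedBall (0 : UnitAddTorus (Fin n)) δ
  · have : t + u ∈ Metric.closedBall t δ := by
      simpa [dist_eq_norm] using hu
    simp [hu, this, mFourier_neg, bp_mFourier_add]
  · have : t + u ∉ Metric.closedBall t δ := by
      simpa [dist_eq_norm] using hu
    simp [hu, this]

lemma bp_mult_tendsto {n : ℕ} (k : Fin n → ℤ) :
    Tendsto (fun δ : ℝ => (∫ s in Metric.closedBall 0 δ, mFourier k s ∂(bpMu n)) /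
      ((2 * δ) ^ n : ℝ)) (𝓝[>] 0) (𝓝 1) := by
  rw [Metric.tendsto_nhds]
  intro η hη
  have hc : ContinuousAt (fun s => mFourier k s) (0 : UnitAddTorus (Fin n)) := by fun_prop
  obtain ⟨r, hr, hr2⟩ := Metric.continuousAt_iff.mp hc (η / 2) (by positivity)
  have h1 : mFourier k (0 : UnitAddTorus (Fin n)) = 1 := by simp [mFourier]
  filter_upwards [Ioo_mem_nhdsGT (show 0 < min r (1/2) by positivity)] with δ hδ
  obtain ⟨h0, hδ⟩ := hδ
  have hr' := hδ.trans_le (min_le_left _ _)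
  have hh' := hδ.trans_le (min_le_right _ _)
  have hV := bp_ball (0 : UnitAddTorus (Fin n)) h0.le (by linarith)
  have hVpos : (0 : ℝ) < (2 * δ) ^ n := by positivity
  have hint : IntegrableOn (fun s => mFourier k s) (Metric.closedBall 0 δ) (bpMu n) :=
    (Continuous.integrable_of_hasCompactSupport (by fun_prop)
        (HasCompactSupport.of_compactSpace _)).integrableOn
  have key : ‖∫ s in Metric.closedBall 0 δ, (mFourier k s - 1) ∂(bpMu n)‖
      ≤ η / 2 * (2 * δ) ^ n := by
    rw [← hV]
    refine norm_setIntegral_le_of_norm_le_const (measure_lt_top _ _) ?_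
    intro s hs
    have := hr2 (lt_of_le_of_lt (Metric.mem_closedBall.mp hs) hr')
    rw [h1, dist_eq_norm] at this
    exact this.le
  rw [integral_sub hint (integrable_const _), setIntegral_const, hV] at key
  rw [dist_eq_norm]
  have hne : (((2 * δ) ^ n : ℝ) : ℂ) ≠ 0 := by exact_mod_cast hVpos.ne'
  rw [div_sub_one hne, norm_div, Complex.norm_real, Real.norm_of_nonneg hVpos.le,
    div_lt_iff₀ hVpos]
  have e : ((2 * δ) ^ n : ℝ) • (1 : ℂ) = (((2 * δ) ^ n : ℝ) : ℂ) := by simp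
  rw [e] at key
  nlinarith

lemma bp_mul_bound {n : ℕ} {p : UnitAddTorus (Fin n) → ℂ} (hp : MemLp p 2 (bpMu n)) {δ : ℝ}
    (h0 : 0 < δ) (h1 : 2 * δ ≤ 1) :
    Summable (fun k => ‖bpCoef p k * ((∫ s in Metric.closedBall 0 δ, mFourier k s ∂(bpMu n)) /
      ((2 * δ) ^ n : ℝ))‖) ∧
    ∑' k, ‖bpCoef p k * ((∫ s in Metric.closedBall 0 δ, mFourier k s ∂(bpMu n)) /
      ((2 * δ) ^ n : ℝ))‖ ≤ √(∫ t, ‖p t‖ ^ 2 ∂(bpMu n)) * √((2 * δ) ^ n) / (2 * δ) ^ n := by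
  have hVpos : (0 : ℝ) < (2 * δ) ^ n := by positivity
  have hV := bp_ball (0 : UnitAddTorus (Fin n)) h0.le h1
  have hψ : MemLp ((Metric.closedBall (0 : UnitAddTorus (Fin n)) δ).indicator
      fun _ => (1 : ℂ)) 2 (bpMu n) :=
    (memLp_const _).indicator Metric.isClosed_closedBall.measurableSet
  have hB := bp_parseval_norm hψ
  have hI : ∫ t, ‖(Metric.closedBall (0 : UnitAddTorus (Fin n)) δ).indicator
      (fun _ => (1 : ℂ)) t‖ ^ 2 ∂(bpMu n) = (2 * δ) ^ n := by
    rw [← hV, ← integral_indicator_one Metric.isClosed_closedBall.measurableSet]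
    congr 1
    ext t
    by_cases ht : t ∈ Metric.closedBall (0 : UnitAddTorus (Fin n)) δ <;> simp [ht]
  rw [hI] at hB
  have hz : ∀ k, ‖bpCoef ((Metric.closedBall (0 : UnitAddTorus (Fin n)) δ).indicator
      fun _ => (1 : ℂ)) k‖ = ‖∫ s in Metric.closedBall 0 δ, mFourier k s ∂(bpMu n)‖ := by
    intro k
    rw [← RCLike.norm_conj, bp_coef_ball, norm_mul, bp_norm_mFourier, one_mul]
  simp only [hz] at hB
  obtain ⟨s1, s2⟩ := bp_cs (fun _ => norm_nonneg _) (fun _ => norm_nonneg _)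
    (bp_parseval_norm hp) hB
  have e : ∀ k, ‖bpCoef p k * ((∫ s in Metric.closedBall 0 δ, mFourier k s ∂(bpMu n)) /
      ((2 * δ) ^ n : ℝ))‖ = ‖bpCoef p k‖ *
      ‖∫ s in Metric.closedBall 0 δ, mFourier k s ∂(bpMu n)‖ / (2 * δ) ^ n := by
    intro k
    rw [norm_mul, norm_div, Complex.norm_real, Real.norm_of_nonneg hVpos.le, mul_div_assoc]
  simp only [e]
  refine ⟨s1.div_const _, ?_⟩
  rw [tsum_div_const]
  gcongr

lemma bp_mult_le {n : ℕ} (k : Fin n → ℤ) {δ : ℝ} (h0 : 0 < δ) (h1 : 2 * δ ≤ 1) :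
    ‖(∫ s in Metric.closedBall 0 δ, mFourier k s ∂(bpMu n)) / ((2 * δ) ^ n : ℝ)‖ ≤ 1 := by
  have hVpos : (0 : ℝ) < (2 * δ) ^ n := by positivity
  rw [norm_div, Complex.norm_real, Real.norm_of_nonneg hVpos.le, div_le_one hVpos,
    ← bp_ball (0 : UnitAddTorus (Fin n)) h0.le h1]
  have := norm_setIntegral_le_of_norm_le_const (μ := bpMu n) (f := fun s => mFourier k s)
    (s := Metric.closedBall 0 δ) (C := 1) (measure_lt_top _ _)
    (fun s _ => (bp_norm_mFourier k s).le)
  simpa using this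

lemma bp_tail {n : ℕ} {E : Set (UnitAddTorus (Fin n))} (hE : IsClosed E) :
    Tendsto (fun δ : ℝ => (bpMu n).real (Metric.thickening (2 * δ) E \ E)) (𝓝[>] 0) (𝓝 0) := by
  have h := tendsto_measure_thickening_of_isClosed (μ := bpMu n) (s := E)
    ⟨1, one_pos, measure_ne_top _ _⟩ hE
  have h2 : Tendsto (fun δ : ℝ => 2 * δ) (𝓝[>] 0) (𝓝[>] 0) := by
    refine tendsto_nhdsWithin_iff.mpr ⟨?_, ?_⟩
    · have : Tendsto (fun δ : ℝ => 2 * δ) (𝓝 0) (𝓝 (2 * 0)) :=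
        (continuous_const.mul continuous_id).tendsto _
      rw [mul_zero] at this
      exact this.mono_left nhdsWithin_le_nhds
    · filter_upwards [self_mem_nhdsWithin] with δ hδ
      have : (0 : ℝ) < δ := hδ
      simp [this]
  have h3 := (ENNReal.tendsto_toReal (measure_ne_top (bpMu n) E)).comp (h.comp h2)
  have h4 := h3.sub_const ((bpMu n).real E)
  rw [← measureReal_def, sub_self] at h4
  refine h4.congr' ?_
  filter_upwards [self_mem_nhdsWithin] with δ hδ
  have hδ' : (0 : ℝ) < δ := hδ
  rw [measureReal_sdiff (Metric.self_subset_thickening (by positivity) _) hE.measurableSet]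
  rfl

theorem bp_unit {n : ℕ} (f : UnitAddTorus (Fin n) → ℂ) (a : (Fin n → ℤ) → ℂ)
    (ha : ∀ t, HasSum (fun k => a k * mFourier k t) (f t)) (hs : Summable fun k => ‖a k‖)
    (C : ℝ) (hC : 0 ≤ C)
    (hb : ∀ x y, f y = 0 → ‖f x‖ ≤ C * dist x y ^ ((n : ℝ) / 2)) (ε : ℝ) (hε : 0 < ε) :
    ∃ (g : UnitAddTorus (Fin n) → ℂ) (b : (Fin n → ℤ) → ℂ),
      (∀ t, HasSum (fun k => b k * mFourier k t) (g t)) ∧ (Summable fun k => ‖b k‖) ∧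
      (∃ U : Set (UnitAddTorus (Fin n)), IsOpen U ∧ {s | f s = 0} ⊆ U ∧ ∀ t ∈ U, g t = 0) ∧
      ∑' k, ‖a k - b k‖ < ε := by
  have hcont := bp_cont ha hs
  set E : Set (UnitAddTorus (Fin n)) := {s | f s = 0} with hEdef
  have hEcl : IsClosed E := isClosed_eq hcont continuous_const
  have hfL : MemLp f 2 (bpMu n) := hcont.memLp_of_hasCompactSupport
    (HasCompactSupport.of_compactSpace _)
  set m : ℝ → (Fin n → ℤ) → ℂ := fun δ k =>
    (∫ s in Metric.closedBall 0 δ, mFourier k s ∂(bpMu n)) / ((2 * δ) ^ n : ℝ) with hm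
  have lim1 : Tendsto (fun δ => ∑' k, ‖a k‖ * ‖1 - m δ k‖) (𝓝[>] 0) (𝓝 0) := by
    have := tendsto_tsum_of_dominated_convergence (𝓕 := 𝓝[>] (0 : ℝ))
      (f := fun δ k => ‖a k‖ * ‖1 - m δ k‖) (g := fun _ => (0 : ℝ))
      (bound := fun k => ‖a k‖ * 2) (hs.mul_right 2) (by
        intro k
        have h := (((bp_mult_tendsto k).const_sub 1).norm).const_mul ‖a k‖
        rw [sub_self, norm_zero, mul_zero] at h
        exact h) (by
        filter_upwards [Ioo_mem_nhdsGT (show (0 : ℝ) < 1 / 2 by norm_num)] with δ hδ k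
        rw [norm_mul, norm_norm, norm_norm]
        gcongr
        refine (norm_sub_le _ _).trans ?_
        have := bp_mult_le k hδ.1 (by linarith [hδ.2])
        rw [norm_one]
        change 1 + ‖(∫ s in Metric.closedBall 0 δ, mFourier k s ∂(bpMu n)) /
          ((2 * δ) ^ n : ℝ)‖ ≤ 2
        linarith)
    simpa using this
  have lim2 : Tendsto (fun δ : ℝ => C * √((bpMu n).real (Metric.thickening (2 * δ) E \ E)))
      (𝓝[>] 0) (𝓝 0) := by
    have := ((Real.continuous_sqrt.tendsto 0).comp (bp_tail hEcl)).const_mul C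
    simpa using this
  obtain ⟨δ, ⟨hδ0, hδ1⟩, hd1, hd2⟩ := (Filter.Eventually.and
    (show ∀ᶠ δ : ℝ in 𝓝[>] 0, δ ∈ Set.Ioo (0 : ℝ) (1 / 2) from Ioo_mem_nhdsGT (by norm_num))
    ((lim1.eventually_lt_const (half_pos hε)).and
      (lim2.eventually_lt_const (half_pos hε)))).exists
  have hδ2 : 2 * δ ≤ 1 := by linarith
  have hVpos : (0 : ℝ) < (2 * δ) ^ n := by positivity
  set N := Metric.thickening (2 * δ) E with hN
  have hNm : MeasurableSet N := Metric.isOpen_thickening.measurableSet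
  have hhL : MemLp (Nᶜ.indicator f) 2 (bpMu n) := hfL.indicator hNm.compl
  have hqL : MemLp (N.indicator f) 2 (bpMu n) := hfL.indicator hNm
  obtain ⟨hb1, -⟩ := bp_mul_bound hhL hδ0 hδ2
  obtain ⟨hq1, hq2⟩ := bp_mul_bound hqL hδ0 hδ2
  have hsplit : ∀ k, a k = bpCoef (Nᶜ.indicator f) k + bpCoef (N.indicator f) k := by
    intro k
    have hc : MemLp (fun t => mFourier (-k) t) 2 (bpMu n) :=
      Continuous.memLp_of_hasCompactSupport (by fun_prop) (HasCompactSupport.of_compactSpace _)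
    rw [← bp_coef_eq ha hs k, bpCoef, bpCoef, bpCoef, ← integral_add]
    · congr 1
      ext t
      rw [← mul_add]
      congr 1
      by_cases ht : t ∈ N <;> simp [ht]
    · exact hc.integrable_mul hhL
    · exact hc.integrable_mul hqL
  refine ⟨fun t => ∑' k, bpCoef (Nᶜ.indicator f) k * m δ k * mFourier k t,
    fun k => bpCoef (Nᶜ.indicator f) k * m δ k, ?_, hb1, ?_, ?_⟩
  · intro t
    refine (Summable.of_norm ?_).hasSum
    simp only [norm_mul _ (mFourier _ t), bp_norm_mFourier, mul_one]
    exact hb1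
  · refine ⟨Metric.thickening δ E, Metric.isOpen_thickening,
      Metric.self_subset_thickening hδ0 _, ?_⟩
    intro t ht
    have hψ : MemLp ((Metric.closedBall t δ).indicator fun _ => (1 : ℂ)) 2 (bpMu n) :=
      (memLp_const _).indicator Metric.isClosed_closedBall.measurableSet
    have h := bp_parseval hψ hhL
    have hzero : ∀ s, conj ((Metric.closedBall t δ).indicator (fun _ => (1 : ℂ)) s) *
        Nᶜ.indicator f s = 0 := by
      intro s
      by_cases hst : s ∈ Metric.closedBall t δ
      · have : s ∈ N := by
          obtain ⟨y, hy, hyt⟩ := Metric.mem_thickening_iff.mp ht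
          refine Metric.mem_thickening_iff.mpr ⟨y, hy, ?_⟩
          have := dist_triangle s t y
          have := Metric.mem_closedBall.mp hst
          linarith
        simp [this]
      · simp [hst]
    simp only [hzero, integral_zero, bp_coef_ball] at h
    have h' := h.mul_right ((((2 * δ) ^ n : ℝ) : ℂ)⁻¹)
    rw [zero_mul] at h'
    refine Eq.trans (tsum_congr fun k => ?_) h'.tsum_eq
    simp only [hm]
    rw [div_eq_mul_inv]
    ring
  · have hqint : √(∫ t, ‖N.indicator f t‖ ^ 2 ∂(bpMu n)) * √((2 * δ) ^ n) / (2 * δ) ^ n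
        ≤ C * √((bpMu n).real (N \ E)) := by
      have h1 : ∫ t, ‖N.indicator f t‖ ^ 2 ∂(bpMu n) ≤
          C ^ 2 * (2 * δ) ^ n * (bpMu n).real (N \ E) := by
        have h2 : ∫ t, (N \ E).indicator (fun _ => C ^ 2 * (2 * δ) ^ n) t ∂(bpMu n)
            = C ^ 2 * (2 * δ) ^ n * (bpMu n).real (N \ E) := by
          rw [integral_indicator_const _ (hNm.diff hEcl.measurableSet), smul_eq_mul, mul_comm]
        rw [← h2]
        refine integral_mono (hqL.integrable_norm_pow (by norm_num))
          ((integrable_const _).indicator (hNm.diff hEcl.measurableSet)) ?_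
        intro t
        by_cases htN : t ∈ N
        · by_cases htE : t ∈ E
          · have : f t = 0 := htE
            simp [htN, htE, this]
          · simp only [htN, Set.indicator_of_mem, Set.mem_sdiff, htE, not_false_eq_true,
              and_self]
            obtain ⟨y, hy, hyt⟩ := Metric.mem_thickening_iff.mp htN
            have h3 : ‖f t‖ ≤ C * (2 * δ) ^ ((n : ℝ) / 2) :=
              (hb t y hy).trans (by gcongr)
            calc ‖f t‖ ^ 2 ≤ (C * (2 * δ) ^ ((n : ℝ) / 2)) ^ 2 := by gcongr
              _ = C ^ 2 * (2 * δ) ^ n := by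
                rw [mul_pow, ← Real.rpow_natCast ((2 * δ) ^ ((n : ℝ) / 2)),
                  ← Real.rpow_mul (by positivity)]
                congr 1
                rw [← Real.rpow_natCast]
                congr 1
                push_cast
                ring
        · simp [htN]
      rw [div_le_iff₀ hVpos]
      calc _ ≤ √(C ^ 2 * (2 * δ) ^ n * (bpMu n).real (N \ E)) * √((2 * δ) ^ n) := by gcongr
        _ = C * √((bpMu n).real (N \ E)) * (2 * δ) ^ n := by
          rw [Real.sqrt_mul (by positivity), Real.sqrt_mul (by positivity),
            Real.sqrt_sq hC]
          have hsq := Real.mul_self_sqrt hVpos.le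
          linear_combination C * √((bpMu n).real (N \ E)) * hsq
    have hs1 : Summable fun k => ‖a k‖ * ‖1 - m δ k‖ := by
      refine Summable.of_nonneg_of_le (fun k => by positivity) (fun k => ?_) (hs.mul_right 2)
      gcongr
      refine (norm_sub_le _ _).trans ?_
      have : ‖m δ k‖ ≤ 1 := bp_mult_le k hδ0 hδ2
      rw [norm_one]
      linarith
    have hle : ∀ k, ‖a k - bpCoef (Nᶜ.indicator f) k * m δ k‖ ≤
        ‖a k‖ * ‖1 - m δ k‖ + ‖bpCoef (N.indicator f) k * m δ k‖ := by
      intro k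
      have : a k - bpCoef (Nᶜ.indicator f) k * m δ k =
          a k * (1 - m δ k) + bpCoef (N.indicator f) k * m δ k := by
        rw [hsplit k]; ring
      rw [this, ← norm_mul]
      exact norm_add_le _ _
    have hss := hs1.add hq1
    calc ∑' k, ‖a k - bpCoef (Nᶜ.indicator f) k * m δ k‖
        ≤ ∑' k, (‖a k‖ * ‖1 - m δ k‖ + ‖bpCoef (N.indicator f) k * m δ k‖) :=
          (Summable.of_nonneg_of_le (fun k => norm_nonneg _) hle hss).tsum_le_tsum hle hss
      _ = ∑' k, ‖a k‖ * ‖1 - m δ k‖ + ∑' k, ‖bpCoef (N.indicator f) k * m δ k‖ :=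
          hs1.tsum_add hq1
      _ < ε := by
        have := hq2.trans hqint
        simp only [hm] at hd1 ⊢
        linarith

lemma bp_two_pi_ne : (2 * π) ≠ 0 := by positivity

/-- The rescaling homeomorphism between the unit circle and the circle of length `2π`. -/
noncomputable def bpCirc : UnitAddCircle ≃ₜ AddCircle (2 * π) :=
  AddCircle.homeomorphAddCircle 1 (2 * π) one_ne_zero bp_two_pi_ne

lemma bpCirc_coe (x : ℝ) : bpCirc (x : UnitAddCircle) = ((2 * π * x : ℝ) : AddCircle (2 * π)) := by
  have : bpCirc (x : UnitAddCircle) = ((x * (1⁻¹ * (2 * π)) : ℝ) : AddCircle (2 * π)) := rfl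
  rw [this]
  congr 1
  ring

lemma bpCirc_fourier (k : ℤ) (x : UnitAddCircle) : fourier k (bpCirc x) = fourier k x := by
  induction x using QuotientAddGroup.induction_on with
  | H x =>
    rw [bpCirc_coe, fourier_coe_apply, fourier_coe_apply]
    congr 1
    have : (π : ℂ) ≠ 0 := by exact_mod_cast Real.pi_ne_zero
    push_cast
    field_simp

lemma bpCirc_dist (x y : UnitAddCircle) : dist (bpCirc x) (bpCirc y) ≤ 2 * π * dist x y := by
  induction x using QuotientAddGroup.induction_on with
  | H x =>
    induction y using QuotientAddGroup.induction_on with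
    | H y =>
      rw [bpCirc_coe, bpCirc_coe, dist_eq_norm, dist_eq_norm, ← AddCircle.coe_sub,
        ← AddCircle.coe_sub, ← mul_sub]
      have h := AddCircle.norm_coe_mul 1 (x - y) (2 * π)
      rw [abs_of_nonneg (by positivity)] at h
      have key : ∀ q : ℝ, q = 2 * π * 1 → ‖((2 * π * (x - y) : ℝ) : AddCircle q)‖ =
          2 * π * ‖((x - y : ℝ) : AddCircle (1 : ℝ))‖ := by
        rintro q rfl
        exact h
      exact (key (2 * π) (mul_one _).symm).le

/-- The rescaling homeomorphism between the two models of the torus. -/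
noncomputable def bpTor (n : ℕ) : UnitAddTorus (Fin n) ≃ₜ Torus n :=
  Homeomorph.piCongrRight fun _ => bpCirc

lemma bpTor_char {n : ℕ} (k : Fin n → ℤ) (x : UnitAddTorus (Fin n)) :
    torusChar k (bpTor n x) = mFourier k x := by
  change ∏ j, fourier (k j) (bpCirc (x j)) = ∏ j, fourier (k j) (x j)
  simp only [bpCirc_fourier]

lemma bpTor_dist {n : ℕ} (x y : UnitAddTorus (Fin n)) :
    dist (bpTor n x) (bpTor n y) ≤ 2 * π * dist x y := by
  refine (dist_pi_le_iff (by positivity)).mpr fun i => ?_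
  refine (bpCirc_dist (x i) (y i)).trans ?_
  gcongr
  exact dist_le_pi_dist x y i

end BPAux

/-- **classical Beurling–Pollard theorem.** If `f ∈ A(𝕋ⁿ)` satisfies
`|f(t)| ≤ C · d(t, null f)^{n/2}` for all `t` (with `d(t, ∅) = ∞`), then `f` admits
spectral synthesis in `A(𝕋ⁿ)`: for every `ε > 0` there is `g ∈ A(𝕋ⁿ)` vanishing on a
neighborhood of `null f` with `‖f - g‖_{A(𝕋ⁿ)} < ε`. -/
theorem beurling_pollard_fourier_algebra
    {n : ℕ} (hn : 0 < n) (f : Torus n → ℂ) (a : (Fin n → ℤ) → ℂ)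
    (ha : HasFourierCoeffs f a) (hsum : Summable fun k => ‖a k‖)
    (C : ℝ) (hC : 0 < C)
    (hbound : ∀ t : Torus n, (‖f t‖₊ : ℝ≥0∞) ≤
      ENNReal.ofReal C * EMetric.infEdist t {s | f s = 0} ^ ((n : ℝ) / 2)) :
    ∀ ε : ℝ, 0 < ε → ∃ (g : Torus n → ℂ) (b : (Fin n → ℤ) → ℂ),
      HasFourierCoeffs g b ∧ (Summable fun k => ‖b k‖) ∧
      (∃ U : Set (Torus n), IsOpen U ∧ {s | f s = 0} ⊆ U ∧ ∀ t ∈ U, g t = 0) ∧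
      ∑' k, ‖a k - b k‖ < ε := by
  intro ε hε
  have hpi : (0 : ℝ) ≤ 2 * π := by positivity
  obtain ⟨g, b, h1, h2, ⟨U, hU, hUE, hUg⟩, h4⟩ := bp_unit (fun x => f (bpTor n x)) a
    (fun t => by simpa only [bpTor_char] using ha (bpTor n t)) hsum
    (C * (2 * π) ^ ((n : ℝ) / 2)) (by positivity) (by
      intro x y hy
      have hle : EMetric.infEdist (bpTor n x) {s | f s = 0} ≤
          ENNReal.ofReal (2 * π * dist x y) := by
        refine (Metric.infEDist_le_edist_of_mem (show bpTor n y ∈ {s | f s = 0} from hy)).trans ?_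
        rw [edist_dist]
        exact ENNReal.ofReal_le_ofReal (bpTor_dist x y)
      have hn2 : (0 : ℝ) ≤ (n : ℝ) / 2 := by positivity
      have h := (hbound (bpTor n x)).trans
        (mul_le_mul_right (ENNReal.rpow_le_rpow hle hn2) (ENNReal.ofReal C))
      rw [ENNReal.ofReal_rpow_of_nonneg (by positivity) hn2, ← ENNReal.ofReal_mul hC.le,
        ← enorm_eq_nnnorm, ← ofReal_norm, ENNReal.ofReal_le_ofReal_iff (by positivity),
        Real.mul_rpow hpi dist_nonneg, ← mul_assoc] at h
      exact h) ε hε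
  refine ⟨fun t => g ((bpTor n).symm t), b, ?_, h2,
    ⟨(bpTor n).symm ⁻¹' U, hU.preimage (bpTor n).symm.continuous, ?_, ?_⟩, h4⟩
  · intro t
    have := h1 ((bpTor n).symm t)
    simpa only [← bpTor_char, Homeomorph.apply_symm_apply] using this
  · intro s hs
    apply hUE
    simpa using hs
  · intro t ht
    exact hUg _ ht
end

section
/- Fix α ≥ 0 and β > max(α − 1/2, 0). For x ∈ ℝⁿ let δ(x) = (1−|x|²)^β if |x| ≤ 1 and δ(x) = 0 otherwise, and for ε ∈ (0,1] let δ_ε(x) = ε^{−n}δ(x/ε)/‖δ‖_{L¹}, regarded as a function on 𝕋ⁿ = [−π,π)ⁿ. Then there exists a constant D > 0 such that for all ε ∈ (0,1], Σ_{k∈ℤⁿ} |δ̂_ε(k)|²(1+|k|)^{2α} ≤ D·ε^{−(2α+n)}, where δ̂_ε(k) = ∫_{𝕋ⁿ} δ_ε(t)e^{ik·t} dt. -/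
open scoped Real ENNReal
open MeasureTheory

noncomputable section

/-- Euclidean norm `|k| = (k₁² + … + k_n²)^{1/2}` of a multi-index `k ∈ ℤⁿ`. -/
def zNorm {n : ℕ} (k : Fin n → ℤ) : ℝ :=
  Real.sqrt (∑ j, ((k j : ℝ)) ^ 2)

/-- The bump function `δ(x) = (1 - |x|²)^β` for `|x| ≤ 1`, and `0` otherwise. -/
def bump (n : ℕ) (β : ℝ) (x : EuclideanSpace ℝ (Fin n)) : ℝ :=
  if ‖x‖ ≤ 1 then (1 - ‖x‖ ^ 2) ^ β else 0

/-- The normalized dilate `δ_ε(x) = ε^{-n} δ(x/ε) / ‖δ‖_{L¹}`.  For `ε ≤ 1` it is supported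
in the unit ball, hence may be regarded as a function on `𝕋ⁿ = [-π,π)ⁿ`. -/
def bumpScaled (n : ℕ) (β ε : ℝ) (x : EuclideanSpace ℝ (Fin n)) : ℝ :=
  (ε ^ n)⁻¹ * bump n β (ε⁻¹ • x) / (∫ y, bump n β y)

/-- The Fourier coefficient `δ̂_ε(k) = ∫ δ_ε(t) e^{i k·t} dt`.  (For `0 < ε ≤ 1` the
function `δ_ε` is supported in the unit ball `⊆ [-π,π]ⁿ`, so the integral over `ℝⁿ`
coincides with the integral over the torus `𝕋ⁿ`.) -/
def bumpFourierCoeff (n : ℕ) (β ε : ℝ) (k : Fin n → ℤ) : ℂ :=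
  ∫ t : EuclideanSpace ℝ (Fin n),
    (bumpScaled n β ε t : ℂ) * Complex.exp (Complex.I * ∑ j, (k j : ℂ) * (t j : ℂ))


lemma sonine (a : ℝ) (ha : 1 ≤ a) (y y1 : ℝ → ℝ)
    (h0 : ∀ r, 0 < r → HasDerivAt y (y1 r) r)
    (h1 : ∀ r, 0 < r → HasDerivAt y1 (-y r - 2 * a / r * y1 r) r) :
    ∃ r0 C : ℝ, 0 < r0 ∧ ∀ r, r0 ≤ r → |r ^ a * y r| ≤ C := by
  set c := a * (a - 1) with hc
  have hc0 : 0 ≤ c := mul_nonneg (by linarith) (by linarith)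
  set q : ℝ → ℝ := fun r => 1 - c / r ^ 2 with hq
  set u : ℝ → ℝ := fun r => r ^ a * y r with hu
  set v : ℝ → ℝ := fun r => r ^ a * (a / r * y r + y1 r) with hv
  have hpow : ∀ r : ℝ, 0 < r → HasDerivAt (fun r : ℝ => r ^ a) (a / r * r ^ a) r := by
    intro r hr
    have := Real.hasDerivAt_rpow_const (x := r) (p := a) (Or.inl hr.ne')
    refine HasDerivAt.congr_deriv (this) ?_
    rw [Real.rpow_sub_one hr.ne']; ring
  have hinv : ∀ r : ℝ, 0 < r → HasDerivAt (fun r : ℝ => a / r) (-(a / r ^ 2)) r := by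
    intro r hr
    have := (hasDerivAt_inv hr.ne').const_mul a
    refine HasDerivAt.congr_deriv (this) ?_
    ring
  have hud : ∀ r, 0 < r → HasDerivAt u (v r) r := by
    intro r hr
    refine HasDerivAt.congr_deriv ((hpow r hr).mul (h0 r hr)) ?_
    simp only [hv]; ring
  have hvd : ∀ r, 0 < r → HasDerivAt v (-(q r) * u r) r := by
    intro r hr
    refine HasDerivAt.congr_deriv ((hpow r hr).mul (((hinv r hr).mul (h0 r hr)).add (h1 r hr))) ?_
    simp only [hq, hu, hc, Pi.add_apply, Pi.mul_apply]
    field_simp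
    ring
  have hqd : ∀ r, 0 < r → HasDerivAt q (2 * c / r ^ 3) r := by
    intro r hr
    have := ((hasDerivAt_pow 2 r).inv (by positivity)).const_mul c |>.const_sub 1
    refine HasDerivAt.congr_deriv (this) ?_
    field_simp
    try simp only [Nat.cast_ofNat]
    try ring
  have hqpos : ∀ r, Real.sqrt c + 1 ≤ r → 0 < q r := by
    intro r hr
    have hs := Real.sqrt_nonneg c
    have hs2 := Real.sq_sqrt hc0
    have hr0 : 0 < r := by linarith
    simp only [hq]
    rw [sub_pos, div_lt_one (by positivity)]
    nlinarith
  set E : ℝ → ℝ := fun r => u r ^ 2 + v r ^ 2 / q r with hE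
  have hEd : ∀ r, Real.sqrt c + 1 ≤ r → HasDerivAt E (-(v r ^ 2 * (2 * c / r ^ 3) / q r ^ 2)) r := by
    intro r hr
    have hs := Real.sqrt_nonneg c
    have hr0 : 0 < r := by linarith
    have hq0 := (hqpos r hr).ne'
    refine HasDerivAt.congr_deriv (((hud r hr0).pow 2).add (((hvd r hr0).pow 2).div (hqd r hr0) hq0)) ?_
    simp only [Pi.pow_apply]
    generalize q r = Q at *
    field_simp
    try simp only [Nat.cast_ofNat]
    try ring
  have hanti : AntitoneOn E (Set.Ici (Real.sqrt c + 1)) := by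
    apply antitoneOn_of_deriv_nonpos (convex_Ici _)
    · intro r hr; exact (hEd r hr).continuousAt.continuousWithinAt
    · intro r hr
      rw [interior_Ici] at hr
      exact (hEd r (le_of_lt hr)).differentiableAt.differentiableWithinAt
    · intro r hr
      rw [interior_Ici] at hr
      rw [(hEd r (le_of_lt hr)).deriv]
      have hs := Real.sqrt_nonneg c
      have hr0 : 0 < r := by have : Real.sqrt c + 1 < r := hr
                             linarith
      have : 0 ≤ v r ^ 2 * (2 * c / r ^ 3) / q r ^ 2 := by positivity
      linarith
  refine ⟨Real.sqrt c + 1, Real.sqrt (E (Real.sqrt c + 1)), by positivity, fun r hr => ?_⟩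
  apply Real.abs_le_sqrt
  have := hanti (Set.mem_Ici.2 le_rfl) (Set.mem_Ici.2 hr) hr
  have h2 : 0 ≤ v r ^ 2 / q r := div_nonneg (sq_nonneg _) (hqpos r hr).le
  have : u r ^ 2 ≤ E r := by simp only [hE]; linarith
  linarith

def Y (γ r : ℝ) : ℝ := ∫ s in (-1:ℝ)..1, (1 - s ^ 2) ^ γ * Real.cos (r * s)

lemma wcont (γ : ℝ) (hγ : 0 < γ) : Continuous (fun s : ℝ => (1 - s ^ 2) ^ γ) :=
  Continuous.rpow_const (by fun_prop) (fun _ => Or.inr hγ.le)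

lemma deriv_under (w : ℝ → ℝ) (hw : Continuous w) (r : ℝ) :
    HasDerivAt (fun r => ∫ s in (-1:ℝ)..1, w s * Real.cos (r * s))
      (∫ s in (-1:ℝ)..1, -(w s * s) * Real.sin (r * s)) r ∧
    HasDerivAt (fun r => ∫ s in (-1:ℝ)..1, w s * Real.sin (r * s))
      (∫ s in (-1:ℝ)..1, (w s * s) * Real.cos (r * s)) r := by
  constructor
  · refine (intervalIntegral.hasDerivAt_integral_of_dominated_loc_of_deriv_le
      (F := fun r s => w s * Real.cos (r * s))
      (F' := fun r s => -(w s * s) * Real.sin (r * s))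
      (bound := fun s => |w s * s|) Filter.univ_mem ?_ ?_ ?_ ?_ ?_ ?_).2
    · exact Filter.Eventually.of_forall fun x => by
        apply Continuous.aestronglyMeasurable; fun_prop
    · apply Continuous.intervalIntegrable; fun_prop
    · apply Continuous.aestronglyMeasurable; fun_prop
    · refine Filter.Eventually.of_forall fun s _ x _ => ?_
      rw [norm_mul, norm_neg, Real.norm_eq_abs, Real.norm_eq_abs]
      exact mul_le_of_le_one_right (abs_nonneg _) (Real.abs_sin_le_one _)
    · apply Continuous.intervalIntegrable; fun_prop
    · refine Filter.Eventually.of_forall fun s _ x _ => ?_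
      have := (((hasDerivAt_id x).mul_const s).cos).const_mul (w s)
      refine HasDerivAt.congr_deriv (this) ?_
      simp; ring
  · refine (intervalIntegral.hasDerivAt_integral_of_dominated_loc_of_deriv_le
      (F := fun r s => w s * Real.sin (r * s))
      (F' := fun r s => (w s * s) * Real.cos (r * s))
      (bound := fun s => |w s * s|) Filter.univ_mem ?_ ?_ ?_ ?_ ?_ ?_).2
    · exact Filter.Eventually.of_forall fun x => by
        apply Continuous.aestronglyMeasurable; fun_prop
    · apply Continuous.intervalIntegrable; fun_prop
    · apply Continuous.aestronglyMeasurable; fun_prop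
    · refine Filter.Eventually.of_forall fun s _ x _ => ?_
      rw [norm_mul, Real.norm_eq_abs, Real.norm_eq_abs]
      exact mul_le_of_le_one_right (abs_nonneg _) (Real.abs_cos_le_one _)
    · apply Continuous.intervalIntegrable; fun_prop
    · refine Filter.Eventually.of_forall fun s _ x _ => ?_
      have := (((hasDerivAt_id x).mul_const s).sin).const_mul (w s)
      refine HasDerivAt.congr_deriv (this) ?_
      simp; ring

lemma Y_parts (γ r : ℝ) (hγ : 0 < γ) :
    r * ∫ s in (-1:ℝ)..1, (1 - s ^ 2) ^ (γ + 1) * Real.cos (r * s) =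
      2 * (γ + 1) * ∫ s in (-1:ℝ)..1, (1 - s ^ 2) ^ γ * s * Real.sin (r * s) := by
  have hw := wcont γ hγ
  have := intervalIntegral.integral_mul_deriv_eq_deriv_mul (a := -1) (b := 1)
    (u := fun s : ℝ => (1 - s ^ 2) ^ (γ + 1)) (v := fun s => Real.sin (r * s))
    (u' := fun s : ℝ => -(2 * (γ + 1)) * ((1 - s ^ 2) ^ γ * s))
    (v' := fun s => r * Real.cos (r * s)) ?_ ?_ ?_ ?_
  · rw [← intervalIntegral.integral_const_mul, ← intervalIntegral.integral_const_mul]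
    have e1 : ∀ s : ℝ, r * ((1 - s ^ 2) ^ (γ + 1) * Real.cos (r * s)) =
      (1 - s ^ 2) ^ (γ + 1) * (r * Real.cos (r * s)) := fun s => by ring
    simp_rw [e1]
    rw [this]
    have : (0:ℝ) ^ (γ + 1) = 0 := Real.zero_rpow (by linarith)
    norm_num [this]
    rw [← intervalIntegral.integral_const_mul]
    congr 1; ext s; ring
  · intro s _
    have h2 := (hasDerivAt_pow 2 s).const_sub 1
    refine HasDerivAt.congr_deriv (h2.rpow_const (p := γ + 1) (Or.inr (by linarith))) ?_
    rw [add_sub_cancel_right]; norm_num; ring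
  · intro s _
    have := ((hasDerivAt_id s).const_mul r).sin
    refine HasDerivAt.congr_deriv (this) ?_
    simp; ring
  · apply Continuous.intervalIntegrable; fun_prop
  · apply Continuous.intervalIntegrable; fun_prop

lemma Y_bound (γ : ℝ) (hγ : 0 < γ) :
    ∃ C : ℝ, 0 ≤ C ∧ ∀ r, 0 ≤ r → |Y γ r| ≤ C * (1 + r) ^ (-(γ + 1)) := by
  have hw := wcont γ hγ
  obtain ⟨r0, C, hr0, hC⟩ := sonine (γ + 1) (by linarith) (Y γ)
    (fun r => ∫ s in (-1:ℝ)..1, -((1 - s ^ 2) ^ γ * s) * Real.sin (r * s))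
    (fun r _ => (deriv_under _ hw r).1) (by
      intro r hr
      refine HasDerivAt.congr_deriv ((deriv_under (fun s => -((1 - s ^ 2) ^ γ * s)) (by fun_prop) r).2) ?_
      have hp := Y_parts γ r hγ
      have e : ∫ s in (-1:ℝ)..1, -((1 - s ^ 2) ^ γ * s) * Real.sin (r * s) =
          - ∫ s in (-1:ℝ)..1, (1 - s ^ 2) ^ γ * s * Real.sin (r * s) := by
        rw [← intervalIntegral.integral_neg]; congr 1; ext s; ring
      have e2 : ∫ s in (-1:ℝ)..1, (1 - s ^ 2) ^ (γ + 1) * Real.cos (r * s) =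
          Y γ r + ∫ s in (-1:ℝ)..1, -((1 - s ^ 2) ^ γ * s) * s * Real.cos (r * s) := by
        unfold Y
        rw [← intervalIntegral.integral_add]
        · apply intervalIntegral.integral_congr
          intro s hs
          rw [Set.uIcc_of_le (by norm_num)] at hs
          have : 0 ≤ 1 - s ^ 2 := by nlinarith [hs.1, hs.2]
          simp only
          rw [Real.rpow_add_one' this (by linarith)]
          ring
        · apply Continuous.intervalIntegrable; fun_prop
        · apply Continuous.intervalIntegrable; fun_prop
      rw [e]
      have : 2 * (γ + 1) / r * ∫ s in (-1:ℝ)..1, (1 - s ^ 2) ^ γ * s * Real.sin (r * s) =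
         ∫ s in (-1:ℝ)..1, (1 - s ^ 2) ^ (γ + 1) * Real.cos (r * s) := by
        rw [div_mul_eq_mul_div, ← hp]; field_simp
      linarith)
  set M := ∫ s in (-1:ℝ)..1, |(1 - s ^ 2) ^ γ| with hM
  have hYM : ∀ r, |Y γ r| ≤ M := by
    intro r
    refine (intervalIntegral.abs_integral_le_integral_abs (by norm_num)).trans ?_
    apply intervalIntegral.integral_mono_on (by norm_num)
    · apply Continuous.intervalIntegrable; fun_prop
    · apply Continuous.intervalIntegrable; fun_prop
    · intro s _
      rw [abs_mul]
      exact mul_le_of_le_one_right (abs_nonneg _) (Real.abs_cos_le_one _)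
  have hM0 : 0 ≤ M := (abs_nonneg _).trans (hYM 0)
  have hC0 : 0 ≤ C := (abs_nonneg _).trans (hC r0 le_rfl)
  refine ⟨M * (1 + r0) ^ (γ + 1) + C * (1 / r0 + 1) ^ (γ + 1), by positivity, fun r hr => ?_⟩
  rw [Real.rpow_neg (by positivity), ← div_eq_mul_inv, le_div_iff₀ (by positivity)]
  rcases le_total r r0 with h | h
  · have : |Y γ r| * (1 + r) ^ (γ + 1) ≤ M * (1 + r0) ^ (γ + 1) := by
      gcongr
      exact hYM r
    have : 0 ≤ C * (1 / r0 + 1) ^ (γ + 1) := by positivity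
    linarith
  · have hrp : 0 < r := by linarith
    have h3 : 1 + r ≤ r * (1 / r0 + 1) := by
      have : 1 ≤ r / r0 := by rw [le_div_iff₀ hr0]; linarith
      have e : r * (1 / r0 + 1) = r / r0 + r := by ring
      linarith
    have h4 : (1 + r) ^ (γ + 1) ≤ r ^ (γ + 1) * (1 / r0 + 1) ^ (γ + 1) := by
      rw [← Real.mul_rpow hr (by positivity)]
      gcongr
    have h5 := hC r h
    rw [abs_mul, abs_of_nonneg (by positivity)] at h5
    have : |Y γ r| * (1 + r) ^ (γ + 1) ≤ C * (1 / r0 + 1) ^ (γ + 1) := by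
      calc _ ≤ |Y γ r| * (r ^ (γ + 1) * (1 / r0 + 1) ^ (γ + 1)) := by gcongr
        _ = (r ^ (γ + 1) * |Y γ r|) * (1 / r0 + 1) ^ (γ + 1) := by ring
        _ ≤ _ := by gcongr
    have : 0 ≤ M * (1 + r0) ^ (γ + 1) := by positivity
    linarith

lemma lattice_sum (n : ℕ) (p : ℝ) (hp : (n:ℝ) < p) :
    ∃ C : ℝ, 0 ≤ C ∧ ∀ ε : ℝ, 0 < ε → ε ≤ 1 → ∀ S : Finset (Fin n → ℤ),
      ∑ k ∈ S, (1 + ε * ‖(fun j => (k j : ℝ))‖) ^ (-p) ≤ C * (ε ^ n)⁻¹ := by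
  have hp0 : 0 < p := lt_of_le_of_lt (Nat.cast_nonneg n) hp
  have hint : Integrable (fun x : Fin n → ℝ => (1 + ‖x‖) ^ (-p)) :=
    integrable_one_add_norm (by simpa using hp)
  refine ⟨2 ^ p * ∫ x : Fin n → ℝ, (1 + ‖x‖) ^ (-p), by positivity, fun ε h0 h1 S => ?_⟩
  set G : (Fin n → ℝ) → ℝ := fun x => (1 + ‖ε • x‖) ^ (-p) with hG
  have hGi : Integrable G := hint.comp_smul h0.ne'
  have hGint : ∫ x, G x = (ε ^ n)⁻¹ * ∫ x : Fin n → ℝ, (1 + ‖x‖) ^ (-p) := by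
    have := Measure.integral_comp_smul (volume : Measure (Fin n → ℝ)) (fun x => (1 + ‖x‖) ^ (-p)) ε
    simp only [hG]
    rw [this]
    simp [abs_of_pos h0]
  set Q : (Fin n → ℤ) → Set (Fin n → ℝ) := fun k => Set.univ.pi fun j => Set.Ico (k j : ℝ) (k j + 1) with hQ
  have hQm : ∀ k, MeasurableSet (Q k) := fun k => MeasurableSet.univ_pi fun _ => measurableSet_Ico
  have hQv : ∀ k, volume.real (Q k) = 1 := by
    intro k
    simp [hQ, Measure.real, Real.volume_pi_Ico, volume_pi_pi]
  have hd : Pairwise (Function.onFun Disjoint Q) := by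
    intro k l hkl
    rw [Function.onFun, Set.disjoint_left]
    intro x hx hy
    apply hkl
    ext j
    have a := hx j (Set.mem_univ _)
    have b := hy j (Set.mem_univ _)
    rw [← Int.floor_eq_iff.2 ⟨a.1, a.2⟩, ← Int.floor_eq_iff.2 ⟨b.1, b.2⟩]
  have hk : ∀ k, (1 + ε * ‖(fun j => (k j : ℝ))‖) ^ (-p) ≤ 2 ^ p * ∫ x in Q k, G x := by
    intro k
    rw [← integral_const_mul]
    have : (1 + ε * ‖(fun j => (k j : ℝ))‖) ^ (-p) = ∫ x in Q k, (1 + ε * ‖(fun j => (k j : ℝ))‖) ^ (-p) := by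
      rw [setIntegral_const, hQv]; simp
    rw [this]
    apply setIntegral_mono_on _ (hGi.const_mul _).integrableOn (hQm k)
    · intro x hx
      have hx' : ‖x‖ ≤ ‖(fun j => (k j : ℝ))‖ + 1 := by
        rw [pi_norm_le_iff_of_nonneg (by positivity)]
        intro j
        have a := hx j (Set.mem_univ _)
        have b := norm_le_pi_norm (fun j => (k j : ℝ)) j
        simp only [Real.norm_eq_abs] at b ⊢
        have : |x j| ≤ |(k j : ℝ)| + |x j - k j| := by
          have := abs_add_le (k j : ℝ) (x j - k j)
          simpa using this
        have : |x j - k j| ≤ 1 := by rw [abs_le]; constructor <;> linarith [a.1, a.2]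
        linarith
      simp only [hG, norm_smul, Real.norm_eq_abs, abs_of_pos h0]
      rw [Real.rpow_neg (by positivity), Real.rpow_neg (by positivity), ← div_eq_mul_inv,
        le_div_iff₀ (by positivity), mul_comm, ← div_eq_mul_inv, div_le_iff₀ (by positivity),
        ← Real.mul_rpow (by positivity) (by positivity)]
      apply Real.rpow_le_rpow (by positivity) _ hp0.le
      nlinarith [norm_nonneg (fun j => (k j : ℝ))]
    · apply integrableOn_const
      · intro h
        have := hQv k
        simp [Measure.real, h] at this
      · exact enorm_ne_top
  calc _ ≤ ∑ k ∈ S, 2 ^ p * ∫ x in Q k, G x := Finset.sum_le_sum fun k _ => hk k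
    _ = 2 ^ p * ∫ x in ⋃ k ∈ S, Q k, G x := by
      rw [← Finset.mul_sum, integral_biUnion_finset S (fun k _ => hQm k) (fun a _ b _ h => hd h)
        (fun k _ => hGi.integrableOn)]
    _ ≤ 2 ^ p * ∫ x, G x := by
      gcongr
      · refine Filter.Eventually.of_forall fun x => ?_
        simp only [hG]; positivity
      · exact Measure.restrict_le_self
    _ = _ := by rw [hGint]; ring

lemma bump_eq (n : ℕ) (β : ℝ) (hβ : 0 < β) (x : EuclideanSpace ℝ (Fin n)) :
    bump n β x = (max (1 - ‖x‖ ^ 2) 0) ^ β := by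
  unfold bump
  split_ifs with h
  · rw [max_eq_left]; nlinarith [norm_nonneg x]
  · rw [max_eq_right, Real.zero_rpow hβ.ne']; nlinarith [norm_nonneg x]

lemma bump_cont (n : ℕ) (β : ℝ) (hβ : 0 < β) : Continuous (bump n β) := by
  have : bump n β = fun x => (max (1 - ‖x‖ ^ 2) 0) ^ β := funext (bump_eq n β hβ)
  rw [this]
  exact Continuous.rpow_const (by fun_prop) (fun _ => Or.inr hβ.le)

lemma bump_supp (n : ℕ) (β : ℝ) : HasCompactSupport (bump n β) := by
  apply HasCompactSupport.of_support_subset_isCompact (isCompact_closedBall 0 1)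
  intro x hx
  rw [mem_closedBall_zero_iff]
  by_contra h
  exact hx (by simp [bump, h])

/-- the slice weight -/
def W (m : ℕ) (β s : ℝ) (z : Fin m → ℝ) : ℝ := (max (1 - s ^ 2 - ∑ i, z i ^ 2) 0) ^ β

lemma W_int (m : ℕ) (β s : ℝ) (hβ : 0 < β) :
    ∫ z, W m β s z = (max (1 - s ^ 2) 0) ^ (β + m / 2) * ∫ z, W m β 0 z := by
  have hγ : 0 < β + m / 2 := by positivity
  rcases le_or_gt (1 - s ^ 2) 0 with h | h
  · rw [max_eq_right h, Real.zero_rpow hγ.ne', zero_mul]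
    have : ∀ z, W m β s z = 0 := by
      intro z
      unfold W
      have : 0 ≤ ∑ i, z i ^ 2 := Finset.sum_nonneg fun i _ => sq_nonneg _
      rw [max_eq_right (by linarith), Real.zero_rpow hβ.ne']
    simp [this]
  · rw [max_eq_left h.le]
    set R := Real.sqrt (1 - s ^ 2) with hR
    have hR0 : 0 < R := Real.sqrt_pos.2 h
    have hR2 : R ^ 2 = 1 - s ^ 2 := Real.sq_sqrt h.le
    have key : ∀ z, W m β s (R • z) = (1 - s ^ 2) ^ β * W m β 0 z := by
      intro z
      unfold W
      rw [← Real.mul_rpow h.le (le_max_right _ _), mul_max_of_nonneg _ _ h.le]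
      congr 2
      · simp only [Pi.smul_apply, smul_eq_mul, mul_pow, ← Finset.mul_sum, hR2]
        ring
      · simp
    have h1 := Measure.integral_comp_smul (volume : Measure (Fin m → ℝ)) (W m β s) R
    simp_rw [key] at h1
    rw [integral_const_mul] at h1
    simp only [Module.finrank_fintype_fun_eq_card, Fintype.card_fin, smul_eq_mul] at h1
    rw [abs_of_pos (by positivity)] at h1
    have h2 : (1 - s ^ 2) ^ ((m:ℝ) / 2) = R ^ m := by
      rw [hR, Real.sqrt_eq_rpow, ← Real.rpow_natCast _ m, ← Real.rpow_mul h.le]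
      congr 1; ring
    rw [Real.rpow_add h, h2]
    have : R ^ m ≠ 0 := by positivity
    field_simp at h1
    linarith

lemma slice (m : ℕ) (β r : ℝ) (hβ : 0 < β) :
    ∫ t : EuclideanSpace ℝ (Fin (m+1)), bump (m+1) β t * Real.cos (r * t 0) =
      (∫ z, W m β 0 z) * Y (β + m / 2) r := by
  have hγ : 0 < β + m / 2 := by positivity
  have hi : Integrable (fun t : EuclideanSpace ℝ (Fin (m+1)) => bump (m+1) β t * Real.cos (r * t 0)) := by
    apply Continuous.integrable_of_hasCompactSupport
    · have := bump_cont (m+1) β hβ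
      fun_prop
    · exact (bump_supp (m+1) β).mul_right
  have e1 := (PiLp.volume_preserving_toLp (Fin (m+1)))
  have e2 := (volume_preserving_piFinSuccAbove (fun _ : Fin (m+1) => ℝ) 0).symm
  have hE : ∀ p : ℝ × (Fin m → ℝ),
      bump (m+1) β (WithLp.toLp 2 ((MeasurableEquiv.piFinSuccAbove (fun _ : Fin (m+1) => ℝ) 0).symm p)) *
        Real.cos (r * (WithLp.toLp 2 ((MeasurableEquiv.piFinSuccAbove (fun _ : Fin (m+1) => ℝ) 0).symm p) : EuclideanSpace ℝ (Fin (m+1))) 0)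
      = W m β p.1 p.2 * Real.cos (r * p.1) := by
    intro p
    rw [bump_eq _ _ hβ, EuclideanSpace.norm_sq_eq, Fin.sum_univ_succ]
    simp [W, MeasurableEquiv.piFinSuccAbove, Fin.insertNthEquiv]
    left
    ring_nf
  have hi2 : Integrable (fun p : ℝ × (Fin m → ℝ) => W m β p.1 p.2 * Real.cos (r * p.1)) := by
    have h1 := e1.integrable_comp_of_integrable hi
    have h2 := e2.integrable_comp_of_integrable h1
    refine h2.congr (Filter.Eventually.of_forall fun p => ?_)
    exact hE p
  rw [← e1.integral_comp (MeasurableEquiv.toLp 2 _).measurableEmbedding,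
    ← e2.integral_comp (MeasurableEquiv.measurableEmbedding _)]
  simp_rw [hE]
  rw [Measure.volume_eq_prod, integral_prod _ hi2]
  simp only [integral_mul_const]
  have hW := fun s => W_int m β s hβ
  generalize (∫ z, W m β 0 z) = A at hW ⊢
  simp only [hW]
  unfold Y
  rw [intervalIntegral.integral_of_le (by norm_num), ← integral_const_mul]
  rw [← integral_indicator measurableSet_Ioc]
  congr 1; ext s
  by_cases hs : s ∈ Set.Ioc (-1:ℝ) 1
  · rw [Set.indicator_of_mem hs, max_eq_left (by nlinarith [hs.1, hs.2])]; ring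
  · rw [Set.indicator_of_notMem hs, max_eq_right, Real.zero_rpow hγ.ne']
    · ring
    · by_contra h
      apply hs
      constructor <;> nlinarith

lemma fourier_radial (m : ℕ) (β : ℝ) (hβ : 0 < β) (κ : EuclideanSpace ℝ (Fin (m+1))) :
    ∫ t : EuclideanSpace ℝ (Fin (m+1)), (bump (m+1) β t : ℂ) * Complex.exp (Complex.I * (inner ℝ κ t : ℝ)) =
      (((∫ z, W m β 0 z) * Y (β + m / 2) ‖κ‖ : ℝ) : ℂ) := by
  rw [← slice m β ‖κ‖ hβ]
  set e : EuclideanSpace ℝ (Fin (m+1)) := ‖κ‖ • EuclideanSpace.single 0 1 with he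
  have hn : ‖e‖ = ‖κ‖ := by simp [he, norm_smul]
  set L := Submodule.reflection (Submodule.span ℝ {e - κ})ᗮ with hL
  have hLe : L e = κ := Submodule.reflection_sub hn
  have hb : ∀ x y : EuclideanSpace ℝ (Fin (m+1)), ‖x‖ = ‖y‖ → bump (m+1) β x = bump (m+1) β y := by
    intro x y h; simp [bump, h]
  set f : EuclideanSpace ℝ (Fin (m+1)) → ℂ := fun t => (bump (m+1) β t : ℂ) * Complex.exp (Complex.I * (inner ℝ e t : ℝ)) with hf
  have h1 : ∫ t : EuclideanSpace ℝ (Fin (m+1)), (bump (m+1) β t : ℂ) * Complex.exp (Complex.I * (inner ℝ κ t : ℝ)) = ∫ t, f t := by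
    rw [← L.measurePreserving.integral_comp L.toHomeomorph.measurableEmbedding]
    congr 1; ext t
    rw [hb (L t) t (L.norm_map t)]
    conv_lhs => rw [← hLe]
    rw [L.inner_map_map]
  have hfi : Integrable f := by
    apply Continuous.integrable_of_hasCompactSupport
    · have := bump_cont (m+1) β hβ
      fun_prop
    · apply HasCompactSupport.mul_right
      exact (bump_supp (m+1) β).comp_left (g := fun x : ℝ => (x:ℂ)) (by simp)
  have h2 : ∫ t, f t = ∫ t, (f t + f (-t)) / 2 := by
    rw [integral_div, integral_add hfi hfi.comp_neg, integral_neg_eq_self]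
    ring
  rw [h1, h2, ← integral_complex_ofReal]
  congr 1; ext t
  simp only [hf]
  rw [hb (-t) t (norm_neg t)]
  have : inner ℝ e t = ‖κ‖ * t 0 := by
    simp [he, inner_smul_left, EuclideanSpace.inner_single_left]
  rw [inner_neg_right, this]
  push_cast
  rw [Complex.cos]
  rw [mul_comm Complex.I, mul_comm Complex.I]
  ring

lemma coeff_eq (m : ℕ) (β ε : ℝ) (hβ : 0 < β) (hε : 0 < ε) (k : Fin (m+1) → ℤ) :
    bumpFourierCoeff (m+1) β ε k =
      ((((∫ z, W m β 0 z) * Y (β + m / 2) (ε * zNorm k)) / (∫ y, bump (m+1) β y) : ℝ) : ℂ) := by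
  set κ : EuclideanSpace ℝ (Fin (m+1)) := ε • WithLp.toLp 2 (fun j => (k j : ℝ)) with hκ
  have hn : ‖κ‖ = ε * zNorm k := by
    simp [hκ, norm_smul, abs_of_pos hε, EuclideanSpace.norm_eq, zNorm]
  rw [← hn]
  have := fourier_radial m β hβ κ
  push_cast at this ⊢
  rw [← this]
  unfold bumpFourierCoeff bumpScaled
  have h := Measure.integral_comp_inv_smul (volume : Measure (EuclideanSpace ℝ (Fin (m+1))))
    (fun t => (bump (m+1) β t : ℂ) * Complex.exp (Complex.I * (inner ℝ κ t : ℝ))) ε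
  simp only [finrank_euclideanSpace, Fintype.card_fin] at h
  rw [abs_of_pos (by positivity)] at h
  have hk : ∀ t : EuclideanSpace ℝ (Fin (m+1)), ((inner ℝ κ (ε⁻¹ • t) : ℝ) : ℂ) = ∑ j, (k j : ℂ) * (t j : ℂ) := by
    intro t
    rw [hκ, inner_smul_left, inner_smul_right]
    simp only [conj_trivial]
    rw [mul_inv_cancel_left₀ hε.ne', PiLp.inner_apply]
    simp [mul_comm]
  simp_rw [hk] at h
  have e : ∀ t : EuclideanSpace ℝ (Fin (m+1)), (((ε ^ (m+1))⁻¹ * bump (m+1) β (ε⁻¹ • t) / (∫ y, bump (m+1) β y) : ℝ) : ℂ) * Complex.exp (Complex.I * ∑ j, (k j : ℂ) * (t j : ℂ)) =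
    ((ε:ℂ) ^ (m+1))⁻¹ * ((bump (m+1) β (ε⁻¹ • t) : ℂ) * Complex.exp (Complex.I * ∑ j, (k j : ℂ) * (t j : ℂ))) / ((∫ y, bump (m+1) β y : ℝ) : ℂ) := by
    intro t; push_cast; ring
  simp_rw [e]
  rw [integral_div, integral_const_mul, h]
  rw [Complex.real_smul]
  have hε' : (ε : ℂ) ≠ 0 := by exact_mod_cast hε.ne'
  push_cast
  rw [inv_mul_cancel_left₀ (by positivity)]

theorem bump_fourier_weighted_l2_estimate
    {n : ℕ} (hn : 0 < n) (α β : ℝ) (hα : 0 ≤ α) (hβ : max (α - 1/2) 0 < β) :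
    ∃ D : ℝ, 0 < D ∧ ∀ ε : ℝ, 0 < ε → ε ≤ 1 →
      (Summable fun k : Fin n → ℤ =>
        ‖bumpFourierCoeff n β ε k‖ ^ 2 * (1 + zNorm k) ^ (2 * α)) ∧
      ∑' k : Fin n → ℤ, ‖bumpFourierCoeff n β ε k‖ ^ 2 * (1 + zNorm k) ^ (2 * α) ≤
        D * ε ^ (-(2 * α + (n : ℝ))) := by
  obtain ⟨m, rfl⟩ : ∃ m, n = m + 1 := ⟨n - 1, by omega⟩
  have hβ0 : 0 < β := (le_max_right _ _).trans_lt hβ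
  have hβα : α - 1/2 < β := (le_max_left _ _).trans_lt hβ
  have hγ : 0 < β + m / 2 := by positivity
  obtain ⟨C, hC0, hC⟩ := Y_bound (β + m / 2) hγ
  set p : ℝ := 2 * (β + m / 2 + 1) - 2 * α with hp
  have hpn : ((m + 1 : ℕ) : ℝ) < p := by push_cast; rw [hp]; linarith
  have hp0 : 0 < p := lt_of_le_of_lt (Nat.cast_nonneg _) hpn
  obtain ⟨K, hK0, hK⟩ := lattice_sum (m + 1) p hpn
  set B := |(∫ z, W m β 0 z) / (∫ y, bump (m+1) β y)| with hB
  have hB0 : 0 ≤ B := abs_nonneg _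
  refine ⟨(B * C) ^ 2 * K + 1, by positivity, fun ε h0 h1 => ?_⟩
  have hz : ∀ k : Fin (m+1) → ℤ, 0 ≤ zNorm k := fun k => Real.sqrt_nonneg _
  have hnn : ∀ k : Fin (m+1) → ℤ, 0 ≤ ‖bumpFourierCoeff (m+1) β ε k‖ ^ 2 * (1 + zNorm k) ^ (2 * α) := by
    intro k
    have := hz k
    positivity
  have hterm : ∀ k : Fin (m+1) → ℤ, ‖bumpFourierCoeff (m+1) β ε k‖ ^ 2 * (1 + zNorm k) ^ (2 * α) ≤
      (B * C) ^ 2 * ε ^ (-(2 * α)) * (1 + ε * ‖(fun j => (k j : ℝ))‖) ^ (-p) := by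
    intro k
    have hzk := hz k
    have hX : 0 < 1 + ε * zNorm k := by positivity
    have a1 : ‖bumpFourierCoeff (m+1) β ε k‖ ≤ B * C * (1 + ε * zNorm k) ^ (-(β + m / 2 + 1)) := by
      rw [coeff_eq m β ε hβ0 h0 k, Complex.norm_real, Real.norm_eq_abs, mul_div_right_comm, abs_mul,
        mul_assoc]
      exact mul_le_mul_of_nonneg_left (hC _ (by positivity)) hB0
    have a2 : (1 + zNorm k) ^ (2 * α) ≤ ε ^ (-(2 * α)) * (1 + ε * zNorm k) ^ (2 * α) := by
      rw [Real.rpow_neg h0.le, ← Real.inv_rpow h0.le, ← Real.mul_rpow (by positivity) hX.le]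
      apply Real.rpow_le_rpow (by positivity) _ (by positivity)
      have : 1 ≤ ε⁻¹ := (one_le_inv₀ h0).2 h1
      rw [mul_add, inv_mul_cancel_left₀ h0.ne']
      linarith
    have a3 : (1 + ε * zNorm k) ^ (-p) ≤ (1 + ε * ‖(fun j => (k j : ℝ))‖) ^ (-p) := by
      apply Real.rpow_le_rpow_of_nonpos (by positivity) _ (by linarith)
      gcongr
      rw [pi_norm_le_iff_of_nonneg hzk]
      intro j
      rw [Real.norm_eq_abs]
      apply Real.abs_le_sqrt
      exact Finset.single_le_sum (f := fun j => (k j : ℝ) ^ 2) (fun i _ => sq_nonneg _) (Finset.mem_univ j)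
    calc _ ≤ (B * C * (1 + ε * zNorm k) ^ (-(β + m / 2 + 1))) ^ 2 *
          (ε ^ (-(2 * α)) * (1 + ε * zNorm k) ^ (2 * α)) := by gcongr
      _ = (B * C) ^ 2 * ε ^ (-(2 * α)) * (1 + ε * zNorm k) ^ (-p) := by
        have : -p = -(β + m / 2 + 1) + -(β + m / 2 + 1) + 2 * α := by rw [hp]; ring
        rw [this, Real.rpow_add hX, Real.rpow_add hX]
        ring
      _ ≤ _ := by gcongr
  have hsum : ∀ S : Finset (Fin (m+1) → ℤ),
      ∑ k ∈ S, ‖bumpFourierCoeff (m+1) β ε k‖ ^ 2 * (1 + zNorm k) ^ (2 * α) ≤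
        ((B * C) ^ 2 * K + 1) * ε ^ (-(2 * α + ((m + 1 : ℕ) : ℝ))) := by
    intro S
    have e : ε ^ (-(2 * α + ((m + 1 : ℕ) : ℝ))) = ε ^ (-(2 * α)) * (ε ^ (m+1))⁻¹ := by
      rw [neg_add, Real.rpow_add h0, Real.rpow_neg h0.le ((m + 1 : ℕ) : ℝ), Real.rpow_natCast]
    have hE : 0 ≤ ε ^ (-(2 * α + ((m + 1 : ℕ) : ℝ))) := by positivity
    calc _ ≤ ∑ k ∈ S, (B * C) ^ 2 * ε ^ (-(2 * α)) * (1 + ε * ‖(fun j => (k j : ℝ))‖) ^ (-p) :=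
          Finset.sum_le_sum fun k _ => hterm k
      _ = (B * C) ^ 2 * ε ^ (-(2 * α)) * ∑ k ∈ S, (1 + ε * ‖(fun j => (k j : ℝ))‖) ^ (-p) := by
          rw [Finset.mul_sum]
      _ ≤ (B * C) ^ 2 * ε ^ (-(2 * α)) * (K * (ε ^ (m+1))⁻¹) := by
          gcongr
          exact hK ε h0 h1 S
      _ = ((B * C) ^ 2 * K) * ε ^ (-(2 * α + ((m + 1 : ℕ) : ℝ))) := by rw [e]; ring
      _ ≤ _ := by gcongr; linarith
  exact ⟨summable_of_sum_le hnn hsum, Real.tsum_le_of_sum_le hnn hsum⟩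
end
end
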